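/- Let d ≥ 2, let 1/d ≤ k ≤ 1, and let {ρ_{b,x}} (b = 1,…,d+1; x = 1,…,d) be a d-dimensional arbitrary-rank (d+1)-MUB set: each ρ_{b,x} is a positive semidefinite d×d complex matrix with Tr[ρ_{b,x}] = 1, Σ_{b,x} ρ_{b,x} = (d+1)·I, and Tr[ρ_{b,x} ρ_{b',x'}] = k if (b,x) = (b',x'), (1 − k)/(d − 1) if b = b' and x ≠ x', and 1/d if b ≠ b'. Let E = {(1/(d(d+1)))ρ_{b,x}} be the associated arbitrary-rank (d+1)-MUB ensemble. Then for every POVM Q in dimension d, the mutual information satisfies I(E, Q) ≤ log₂( d(k + 1)/(d+1) ); i.e., the accessible information of any arbitrary-rank (d+1)-MUB ensemble is at most log₂( d(k+1)/(d+1) ). -/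

import Mathlib

open Matrix Finset
open scoped BigOperators ComplexOrder

/-- The mutual information (in bits) of a finite joint probability distribution
`p : X → Y → ℝ`, with the convention `0·log₂ 0 = 0` (terms with `p x y = 0` vanish). -/
noncomputable def mutualInfo {X Y : Type*} [Fintype X] [Fintype Y] (p : X → Y → ℝ) : ℝ :=
  ∑ x, ∑ y, p x y * Real.logb 2 (p x y / ((∑ y', p x y') * (∑ x', p x' y)))

/-- `ρ` is a `d`-dimensional arbitrary-rank `(d+1)`-MUB set with parameter `k`:
`d(d+1)` unit-trace PSD matrices `ρ_{b,x}` summing to `(d+1)·I` whose pairwise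
Hilbert-Schmidt inner products are `k` on the diagonal, `(1−k)/(d−1)` within a basis,
and `1/d` across different bases. -/
noncomputable def IsGenMUB (d : ℕ) (k : ℝ)
    (ρ : Fin (d + 1) × Fin d → Matrix (Fin d) (Fin d) ℂ) : Prop :=
  (∀ bx, (ρ bx).PosSemidef) ∧ (∀ bx, (ρ bx).trace = 1) ∧
  (∑ bx, ρ bx = ((d : ℂ) + 1) • 1) ∧
  (∀ bx b'x' : Fin (d + 1) × Fin d, (ρ bx * ρ b'x').trace =
    if bx = b'x' then (k : ℂ)
    else if bx.1 = b'x'.1 then ((1 - (k : ℂ)) / ((d : ℂ) - 1))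
    else ((d : ℂ))⁻¹)

lemma mutualInfo_le_logb {X Y : Type*} [Fintype X] [Fintype Y] {p : X → Y → ℝ} {C : ℝ}
    (hC : 0 < C) (hp : ∀ x y, 0 ≤ p x y) (hsum : ∑ x, ∑ y, p x y = 1)
    (hle : ∑ x, ∑ y, p x y * (p x y / ((∑ y', p x y') * (∑ x', p x' y))) ≤ C) :
    mutualInfo p ≤ Real.logb 2 C := by
  have hlog2 : 0 < Real.log 2 := Real.log_pos one_lt_two
  set r : X → Y → ℝ := fun x y => p x y / ((∑ y', p x y') * (∑ x', p x' y)) with hr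
  have key : ∀ x y, p x y * Real.logb 2 (r x y) ≤
      p x y * (Real.logb 2 C - 1 / Real.log 2) + p x y * r x y * (1 / (C * Real.log 2)) := by
    intro x y
    rcases (hp x y).eq_or_lt with h | h
    · simp [← h]
    have hx : 0 < ∑ y', p x y' :=
      h.trans_le (single_le_sum (f := fun y' => p x y') (fun y' _ => hp x y') (mem_univ y))
    have hy : 0 < ∑ x', p x' y :=
      h.trans_le (single_le_sum (f := fun x' => p x' y) (fun x' _ => hp x' y) (mem_univ x))
    have hrpos : 0 < r x y := div_pos h (mul_pos hx hy)
    have hl := Real.log_le_sub_one_of_pos (div_pos hrpos hC)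
    rw [Real.log_div hrpos.ne' hC.ne'] at hl
    have : Real.logb 2 (r x y) ≤
        Real.logb 2 C - 1 / Real.log 2 + r x y * (1 / (C * Real.log 2)) := by
      have hdiv := div_le_div_of_nonneg_right hl hlog2.le
      have h1 : (r x y / C - 1) / Real.log 2 =
          r x y * (1 / (C * Real.log 2)) - 1 / Real.log 2 := by
        field_simp
      rw [h1, sub_div] at hdiv
      unfold Real.logb
      linarith
    calc _ ≤ p x y * (Real.logb 2 C - 1 / Real.log 2 + r x y * (1 / (C * Real.log 2))) :=
          mul_le_mul_of_nonneg_left this h.le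
      _ = _ := by ring
  calc mutualInfo p ≤ ∑ x, ∑ y, (p x y * (Real.logb 2 C - 1 / Real.log 2) +
        p x y * r x y * (1 / (C * Real.log 2))) :=
        sum_le_sum fun x _ => sum_le_sum fun y _ => key x y
    _ = Real.logb 2 C - 1 / Real.log 2 +
        (∑ x, ∑ y, p x y * r x y) * (1 / (C * Real.log 2)) := by
        simp only [sum_add_distrib, ← sum_mul, hsum, one_mul]
    _ ≤ Real.logb 2 C - 1 / Real.log 2 + C * (1 / (C * Real.log 2)) := by gcongr
    _ = Real.logb 2 C := by field_simp; ring

lemma Matrix.PosSemidef.trace_mul_self_le {n : Type*} [Fintype n]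
    {A : Matrix n n ℂ} (hA : A.PosSemidef) : (A * A).trace ≤ A.trace ^ 2 := by
  rw [sq, trace, trace, sum_mul_sum]
  simp only [diag_apply, mul_apply]
  refine sum_le_sum fun i _ => sum_le_sum fun j _ => ?_
  have h := (hA.submatrix ![i, j]).det_nonneg
  rw [det_fin_two] at h
  simpa using h

lemma Matrix.PosSemidef.trace_mul_nonneg {n : Type*} [Fintype n]
    {A B : Matrix n n ℂ} (hA : A.PosSemidef) (hB : B.PosSemidef) : 0 ≤ (A * B).trace := by
  classical
  open scoped MatrixOrder in
  obtain ⟨C, rfl⟩ := CStarAlgebra.nonneg_iff_eq_star_mul_self.mp hB.nonneg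
  rw [star_eq_conjTranspose, ← Matrix.mul_assoc, trace_mul_comm, ← Matrix.mul_assoc]
  exact (hA.mul_mul_conjTranspose_same C).trace_nonneg

lemma Matrix.IsHermitian.trace_mul_self_nonneg {n : Type*} [Fintype n]
    {A : Matrix n n ℂ} (hA : A.IsHermitian) : 0 ≤ (A * A).trace := by
  have h := (posSemidef_conjTranspose_mul_self A).trace_nonneg
  rwa [hA.eq] at h

lemma IsGenMUB.sum_sum_mul_trace {d : ℕ} {k : ℝ}
    {ρ : Fin (d + 1) × Fin d → Matrix (Fin d) (Fin d) ℂ} (hρ : IsGenMUB d k ρ)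
    (t : Fin (d + 1) × Fin d → ℝ) :
    ∑ x, ∑ y, (t x : ℂ) * t y * (ρ x * ρ y).trace =
      (((k - (1 - k) / (d - 1)) * ∑ x, t x ^ 2 +
        ((1 - k) / (d - 1) - 1 / d) * ∑ b, (∑ i, t (b, i)) ^ 2 +
        1 / d * (∑ x, t x) ^ 2 : ℝ) : ℂ) := by
  have hg : ∀ x y, (t x : ℂ) * t y * (ρ x * ρ y).trace =
      (((k - (1 - k) / (d - 1)) * (if x = y then t x * t y else 0) +
        ((1 - k) / (d - 1) - 1 / d) * (if x.1 = y.1 then t x * t y else 0) +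
        1 / d * (t x * t y) : ℝ) : ℂ) := by
    intro x y
    rw [hρ.2.2.2 x y]
    by_cases h : x = y
    · simp only [h, if_true]; push_cast; ring
    · by_cases h' : x.1 = y.1
      · simp only [h, h', if_true, if_false]; push_cast; ring
      · simp only [h, h', if_false]; push_cast; ring
  simp only [hg, ← Complex.ofReal_sum, sum_add_distrib, ← mul_sum]
  congr 3
  · simp [sq]
  · congr 1
    simp only [Fintype.sum_prod_type, sq, sum_mul_sum]
    refine sum_congr rfl fun b _ => sum_congr rfl fun i _ => ?_
    rw [sum_comm]
    simp
  · rw [sq, sum_mul]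

/-- Every positive semidefinite `A` has index of coincidence at most `(k + 1) (Tr A)²`
against a generalized MUB set. -/
lemma IsGenMUB.sum_sq_trace_mul_le {d : ℕ} (hd : 2 ≤ d) {k : ℝ} (hk : 1 / (d : ℝ) ≤ k)
    {ρ : Fin (d + 1) × Fin d → Matrix (Fin d) (Fin d) ℂ} (hρ : IsGenMUB d k ρ)
    {A : Matrix (Fin d) (Fin d) ℂ} (hA : A.PosSemidef) :
    ∑ x, (ρ x * A).trace.re ^ 2 ≤ (k + 1) * A.trace.re ^ 2 := by
  have hd' : (2 : ℝ) ≤ d := by exact_mod_cast hd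
  have hd0 : (0 : ℝ) < d := by linarith
  have hd1 : (0 : ℝ) < d - 1 := by linarith
  set t : Fin (d + 1) × Fin d → ℝ := fun x => (ρ x * A).trace.re with ht
  set T : ℝ := A.trace.re with hT
  set q : ℝ := (A * A).trace.re with hq
  set F : ℝ := ∑ x, t x ^ 2 with hF
  have htc : ∀ x, (ρ x * A).trace = (t x : ℂ) := fun x =>
    Complex.eq_re_of_ofReal_le (r := 0) (by simpa using (hρ.1 x).trace_mul_nonneg hA)
  have hTc : A.trace = (T : ℂ) :=
    Complex.eq_re_of_ofReal_le (r := 0) (by simpa using hA.trace_nonneg)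
  have hsum : ∑ x, t x = (d + 1) * T := by
    have h : ∑ x, (ρ x * A).trace = ((d : ℂ) + 1) * A.trace := by
      rw [← trace_sum, ← Matrix.sum_mul, hρ.2.2.1]
      simp
    simp only [htc, hTc] at h
    exact_mod_cast h
  set B : Matrix (Fin d) (Fin d) ℂ := ∑ x, (t x : ℂ) • ρ x with hB
  have hBh : B.IsHermitian := by
    rw [IsHermitian, hB, conjTranspose_sum]
    refine sum_congr rfl fun x _ => ?_
    rw [conjTranspose_smul, (hρ.1 x).isHermitian.eq]
    simp
  have hBtr : B.trace = (((d + 1) * T : ℝ) : ℂ) := by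
    simp [hB, trace_sum, hρ.2.1, ← hsum]
  have hBA : (B * A).trace = (F : ℂ) := by
    simp [hB, Matrix.sum_mul, trace_sum, htc, hF, sq]
  set G : ℝ := (B * B).trace.re with hG
  have hAA : (A * A).trace = (q : ℂ) :=
    Complex.eq_re_of_ofReal_le (r := 0) (by simpa using hA.isHermitian.trace_mul_self_nonneg)
  have hBB : (B * B).trace = (G : ℂ) :=
    Complex.eq_re_of_ofReal_le (r := 0) (by simpa using hBh.trace_mul_self_nonneg)
  have hGle : G - (d + 1) ^ 2 * T ^ 2 / d ≤
      (d * k - 1) / (d - 1) * (F - (d + 1) * T ^ 2 / d) := by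
    have hBsum : (B * B).trace = ∑ x, ∑ y, (t x : ℂ) * t y * (ρ x * ρ y).trace := by
      simp only [hB, Matrix.sum_mul, Matrix.mul_sum, trace_sum, smul_mul, Matrix.mul_smul, trace_smul,
        smul_eq_mul]
      refine sum_congr rfl fun x _ => ?_
      rw [mul_sum]
      exact sum_congr rfl fun y _ => by rw [trace_mul_comm (ρ y)]; ring
    have hGe : G = _ := congrArg Complex.re (hBsum.trans (hρ.sum_sum_mul_trace t))
    rw [Complex.ofReal_re, hsum] at hGe
    have hs : (d + 1) * T ^ 2 ≤ ∑ b, (∑ i, t (b, i)) ^ 2 := by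
      have h := sq_sum_le_card_mul_sum_sq (s := univ) (f := fun b => ∑ i, t (b, i))
      rw [← Fintype.sum_prod_type, hsum] at h
      simp only [card_univ, Fintype.card_fin] at h
      push_cast at h
      nlinarith
    have he : (1 - k) / (d - 1) - 1 / d ≤ 0 := by
      rw [div_le_iff₀ hd0] at hk
      rw [sub_nonpos, div_le_div_iff₀ hd1 hd0]
      linarith
    have h1 := mul_le_mul_of_nonpos_left hs he
    have hid : (d * k - 1) / (d - 1) * (F - (d + 1) * T ^ 2 / d) + (d + 1) ^ 2 * T ^ 2 / d =
        (k - (1 - k) / (d - 1)) * F + ((1 - k) / (d - 1) - 1 / d) * ((d + 1) * T ^ 2) +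
          1 / d * ((d + 1) * T) ^ 2 := by
      field_simp
      ring
    linarith
  have hpos : ∀ l : ℝ, 0 ≤ (q - T ^ 2 / d) * (l * l) + (-2 * (F - (d + 1) * T ^ 2 / d)) * l +
      (G - (d + 1) ^ 2 * T ^ 2 / d) := by
    intro l
    set μ : ℝ := ((d + 1) - l) * T / d with hμ
    have hH : ((l : ℂ) • A - B + (μ : ℂ) • 1).IsHermitian := by
      rw [IsHermitian]
      simp [hA.isHermitian.eq, hBh.eq]
    have h := (Complex.le_def.mp hH.trace_mul_self_nonneg).1
    have hexp : ((l : ℂ) • A - B + (μ : ℂ) • 1) * ((l : ℂ) • A - B + (μ : ℂ) • 1) =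
        ((l * l : ℂ)) • (A * A) + B * B + (μ * μ : ℂ) • 1 - (l : ℂ) • (A * B) - (l : ℂ) • (B * A)
          + (2 * l * μ : ℂ) • A - (2 * μ : ℂ) • B := by
      simp only [Matrix.add_mul, Matrix.mul_add, Matrix.sub_mul, Matrix.mul_sub, smul_mul,
        Matrix.mul_smul, Matrix.one_mul, Matrix.mul_one]
      module
    rw [hexp] at h
    simp only [trace_add, trace_sub, trace_smul, trace_mul_comm A B, hBA, hBtr, hTc, hAA, hBB,
      trace_one, smul_eq_mul, Fintype.card_fin] at h
    norm_cast at h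
    have hid : l * l * q + G + μ * μ * d - l * F - l * F + 2 * l * μ * T -
        2 * μ * ((d + 1) * T) = (q - T ^ 2 / d) * (l * l) +
          (-2 * (F - (d + 1) * T ^ 2 / d)) * l + (G - (d + 1) ^ 2 * T ^ 2 / d) := by
      rw [hμ]
      field_simp
      ring
    push_cast at h
    linarith
  have hdisc := discrim_le_zero hpos
  rw [discrim] at hdisc
  have hg0 : 0 ≤ G - (d + 1) ^ 2 * T ^ 2 / d := by simpa using hpos 0
  have hqT : q ≤ T ^ 2 := by
    have h := hA.trace_mul_self_le
    rw [hAA, hTc] at h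
    exact_mod_cast h
  set F' : ℝ := F - (d + 1) * T ^ 2 / d with hF'
  set c : ℝ := (d * k - 1) / (d - 1) with hc
  have hc0 : 0 ≤ c := by
    rw [div_le_iff₀ hd0] at hk
    exact div_nonneg (by linarith) hd1.le
  have hF'le : F' ≤ c * (T ^ 2 - T ^ 2 / d) := by
    have hr : 0 ≤ c * (T ^ 2 - T ^ 2 / d) := by
      exact mul_nonneg hc0 (sub_nonneg.mpr (div_le_self (sq_nonneg T) (by linarith)))
    by_contra! hlt
    have hF0 : 0 < F' := hr.trans_lt hlt
    have hq0 : 0 ≤ q - T ^ 2 / d := by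
      by_contra! hneg
      nlinarith [mul_nonpos_of_nonpos_of_nonneg hneg.le hg0, mul_pos hF0 hF0]
    have h1 : F' * F' ≤ (q - T ^ 2 / d) * (c * F') := by
      have := mul_le_mul_of_nonneg_left hGle hq0
      linarith
    have h2 : F' ≤ (q - T ^ 2 / d) * c :=
      le_of_mul_le_mul_right (by linarith) hF0
    have h3 : (q - T ^ 2 / d) * c ≤ (T ^ 2 - T ^ 2 / d) * c := by gcongr
    linarith
  have hid : c * (T ^ 2 - T ^ 2 / d) + (d + 1) * T ^ 2 / d = (k + 1) * T ^ 2 := by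
    rw [hc]
    field_simp
    ring
  linarith

/-- Accessible information bound for arbitrary-rank `(d+1)`-MUB ensembles: for the
ensemble `E = {(1/(d(d+1)))ρ_{b,x}}` and any POVM `{Π_y}`, the mutual information
satisfies `I(E,Q) ≤ log₂(d(k + 1)/(d+1))`. -/
theorem accessible_information_bound_gen_mub {d : ℕ} (hd : 2 ≤ d) (k : ℝ)
    (hk1 : 1 / (d : ℝ) ≤ k) (hk2 : k ≤ 1)
    (ρ : Fin (d + 1) × Fin d → Matrix (Fin d) (Fin d) ℂ) (hρ : IsGenMUB d k ρ)
    {m : ℕ} (Q : Fin m → Matrix (Fin d) (Fin d) ℂ)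
    (hQpsd : ∀ y, (Q y).PosSemidef) (hQsum : ∑ y, Q y = 1) :
    mutualInfo (fun bx y => ((((d : ℂ) * ((d : ℂ) + 1))⁻¹ • ρ bx) * Q y).trace.re)
      ≤ Real.logb 2 ((d : ℝ) * (k + 1) / ((d : ℝ) + 1)) := by
  have hd0 : (0 : ℝ) < d := by exact_mod_cast (by omega : 0 < d)
  have hk0 : 0 < k := (one_div_pos.mpr hd0).trans_le hk1
  have hN : (0 : ℝ) < d * (d + 1) := by positivity
  set t : Fin (d + 1) × Fin d → Fin m → ℝ := fun x y => (ρ x * Q y).trace.re with ht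
  have htc : ∀ x y, 0 ≤ t x y := fun x y =>
    (Complex.le_def.mp ((hρ.1 x).trace_mul_nonneg (hQpsd y))).1
  have hT0 : ∀ y, 0 ≤ (Q y).trace.re := fun y =>
    (Complex.le_def.mp (hQpsd y).trace_nonneg).1
  have hrow : ∀ x, ∑ y, t x y = 1 := by
    intro x
    rw [← Complex.re_sum, ← trace_sum, ← Matrix.mul_sum, hQsum]
    simp [hρ.2.1]
  have hcol : ∀ y, ∑ x, t x y = (d + 1) * (Q y).trace.re := by
    intro y
    rw [← Complex.re_sum, ← trace_sum, ← Matrix.sum_mul, hρ.2.2.1]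
    simp
  have hTsum : ∑ y, (Q y).trace.re = d := by
    rw [← Complex.re_sum, ← trace_sum, hQsum]
    simp
  have hp : (fun bx y => ((((d : ℂ) * ((d : ℂ) + 1))⁻¹ • ρ bx) * Q y).trace.re) =
      fun bx y => ((d : ℝ) * (d + 1))⁻¹ * t bx y := by
    funext x y
    have hcast : ((d : ℂ) * ((d : ℂ) + 1))⁻¹ = (((d : ℝ) * (d + 1))⁻¹ : ℝ) := by push_cast; rfl
    rw [hcast, Matrix.smul_mul, trace_smul, smul_eq_mul, Complex.re_ofReal_mul]
  rw [hp]
  refine mutualInfo_le_logb (by positivity) (fun x y => ?_) ?_ ?_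
  · exact mul_nonneg (inv_nonneg.mpr hN.le) (htc x y)
  · simp only [← mul_sum, hrow]
    simp
    field_simp
  · simp only [← mul_sum, hrow, hcol]
    rw [sum_comm]
    calc _ ≤ ∑ y, (k + 1) / (d + 1) * (Q y).trace.re := by
          refine sum_le_sum fun y _ => ?_
          rcases (hT0 y).eq_or_lt with h | h
          · simp [← h]
          · have hb := hρ.sum_sq_trace_mul_le hd hk1 (hQpsd y)
            calc _ = (∑ x, t x y ^ 2) * (1 / ((d + 1) * (Q y).trace.re)) := by
                  rw [sum_mul]
                  refine sum_congr rfl fun x _ => ?_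
                  field_simp
              _ ≤ (k + 1) * (Q y).trace.re ^ 2 * (1 / ((d + 1) * (Q y).trace.re)) := by
                  gcongr
              _ = _ := by field_simp
      _ = _ := by
          rw [← mul_sum, hTsum]
          ring
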